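/- Closure of conditional tree patterns under intersection: for all CTP path formulas α and β, either the intersection is unsatisfiable (⟦α⟧_T∩⟦β⟧_T=∅ for every tree T), or there exist finitely many CTP path formulas γ₁,…,γ_k such that for every tree T, ⟦α⟧_T∩⟦β⟧_T = ⟦γ₁⟧_T∪…∪⟦γ_k⟧_T. -/

import Mathlib

/- Trees over a label alphabet -/
structure RTree (A : Type) where
  Node : Type
  E : Node → Node → Prop
  root : Node
  label : Node → Set A

namespace RTree
variable {A : Type}

/-- Tree axioms not requiring finiteness of the node set: finite label sets,
    connectedness from the root, unique parents, acyclicity. -/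
def IsPreTree (T : RTree A) : Prop :=
  (∀ n, (T.label n).Finite) ∧
  (∀ n, Relation.ReflTransGen T.E T.root n) ∧
  (∀ n m m', T.E m n → T.E m' n → m = m') ∧
  (∀ n, ¬ Relation.TransGen T.E n n)

/-- A (finite, rooted, unranked) tree. -/
def IsTree (T : RTree A) : Prop := T.IsPreTree ∧ Finite T.Node

/-- Single-labeled (XML) trees: every node carries exactly one label. -/
def SingleLabeled (T : RTree A) : Prop := ∀ n, ∃ p, T.label n = {p}

end RTree

/- Conditional Tree Patterns: node formulas and path formulas.
   `cstar φ` is the conditional descendant path (↓;?φ)*;↓. -/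
mutual
inductive CNF (A : Type) : Type where
  | lab : A → CNF A
  | top : CNF A
  | and : CNF A → CNF A → CNF A
  | dia : CPF A → CNF A → CNF A
inductive CPF (A : Type) : Type where
  | child : CPF A
  | test : CNF A → CPF A
  | comp : CPF A → CPF A → CPF A
  | cstar : CNF A → CPF A
end

variable {A : Type}

mutual
/-- Satisfaction of CTP node formulas: the set of nodes where the formula holds. -/
def CNF.sat (T : RTree A) : CNF A → Set T.Node
  | .lab p => {n | p ∈ T.label n}
  | .top => Set.univ
  | .and φ ψ => {n | n ∈ CNF.sat T φ ∧ n ∈ CNF.sat T ψ}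
  | .dia α φ => {n | ∃ m, CPF.sem T α n m ∧ m ∈ CNF.sat T φ}
/-- Semantics of CTP path formulas: ⟦(↓;?φ)*;↓⟧ = (E∘⟦?φ⟧)*∘E. -/
def CPF.sem (T : RTree A) : CPF A → T.Node → T.Node → Prop
  | .child => T.E
  | .test φ => fun n m => n = m ∧ n ∈ CNF.sat T φ
  | .comp α β => fun n m => ∃ k, CPF.sem T α n k ∧ CPF.sem T β k m
  | .cstar φ => fun n m =>
      ∃ k, Relation.ReflTransGen (fun a b => T.E a b ∧ b ∈ CNF.sat T φ) n k ∧ T.E k m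
end

section Helpers
open Relation

structure TreeRel {N : Type} (E : N → N → Prop) : Prop where
  up : ∀ n m m', E m n → E m' n → m = m'
  ac : ∀ n, ¬ TransGen E n n

theorem TreeRel.comparable {N : Type} {E : N → N → Prop} (h : TreeRel E) {a b c : N}
    (hac : ReflTransGen E a c) (hbc : ReflTransGen E b c) :
    ReflTransGen E a b ∨ ReflTransGen E b a := by
  induction hac with
  | refl => exact Or.inr hbc
  | tail h1 h2 ih =>
    rcases ReflTransGen.cases_tail hbc with h3 | ⟨d, h3, h4⟩
    · subst h3
      exact Or.inl (h1.tail h2)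
    · have := h.up _ _ _ h2 h4
      subst this
      exact ih h3

theorem TreeRel.child_eq {N : Type} {E : N → N → Prop} (h : TreeRel E) {n k k' m : N}
    (h1 : E n k) (h2 : E n k') (hk : ReflTransGen E k m) (hk' : ReflTransGen E k' m) :
    k = k' := by
  have key : ∀ {x y : N}, E n x → E n y → ReflTransGen E x y → x = y := by
    intro x y hx hy hxy
    rcases ReflTransGen.cases_tail hxy with h3 | ⟨d, h3, h4⟩
    · exact h3.symm
    · have := h.up _ _ _ hy h4
      subst this
      exact absurd (TransGen.head' hx h3) (h.ac _)
  rcases h.comparable hk hk' with h3 | h3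
  · exact key h1 h2 h3
  · exact (key h2 h1 h3).symm

def CS {N : Type} (E : N → N → Prop) (P : N → Prop) (n m : N) : Prop :=
  ∃ k, ReflTransGen (fun a b => E a b ∧ P b) n k ∧ E k m

theorem CS.transGen {N : Type} {E : N → N → Prop} {P : N → Prop} {n m : N}
    (h : CS E P n m) : TransGen E n m := by
  obtain ⟨k, h1, h2⟩ := h
  exact TransGen.tail' (ReflTransGen.mono (fun _ _ h => h.1) _ _ h1) h2

theorem CS.iff_head {N : Type} {E : N → N → Prop} {P : N → Prop} {n m : N} :
    CS E P n m ↔ E n m ∨ ∃ j, E n j ∧ P j ∧ CS E P j m := by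
  constructor
  · rintro ⟨k, h1, h2⟩
    rcases ReflTransGen.cases_head h1 with h3 | ⟨j, h3, h4⟩
    · subst h3; exact Or.inl h2
    · exact Or.inr ⟨j, h3.1, h3.2, k, h4, h2⟩
  · rintro (h | ⟨j, h1, h2, k, h3, h4⟩)
    · exact ⟨n, .refl, h⟩
    · exact ⟨k, .head ⟨h1, h2⟩ h3, h4⟩

theorem TreeRel.cs_iff {N : Type} {E : N → N → Prop} (h : TreeRel E) {P : N → Prop} {n m : N} :
    CS E P n m ↔ TransGen E n m ∧ ∀ j, TransGen E n j → TransGen E j m → P j := by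
  constructor
  · intro hc
    refine ⟨hc.transGen, ?_⟩
    obtain ⟨k, h1, h2⟩ := hc
    intro j hj hjm
    obtain ⟨d, h3, h4⟩ := TransGen.tail'_iff.1 hjm
    have := h.up _ _ _ h2 h4
    subst this
    clear h2 h4 hjm
    induction h1 with
    | refl => exact absurd (hj.trans_left h3) (h.ac _)
    | tail h5 h6 ih =>
      rcases ReflTransGen.cases_tail h3 with h7 | ⟨e, h7, h8⟩
      · subst h7; exact h6.2
      · have := h.up _ _ _ h6.1 h8
        subst this
        exact ih h7
  · rintro ⟨h1, h2⟩
    obtain ⟨k, h3, h4⟩ := TransGen.tail'_iff.1 h1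
    refine ⟨k, ?_, h4⟩
    clear h1
    have h2' : ∀ j, TransGen E n j → ReflTransGen E j k → P j :=
      fun j a b => h2 j a (TransGen.tail' b h4)
    clear h2 h4
    induction h3 with
    | refl => exact .refl
    | tail h5 h6 ih =>
      exact (ih fun j a b => h2' j a (b.tail h6)).tail ⟨h6, h2' _ (TransGen.tail' h5 h6) .refl⟩

theorem CS.trans {N : Type} {E : N → N → Prop} {P : N → Prop} {n k m : N}
    (h : CS E P n k) (hk : P k) (h' : CS E P k m) : CS E P n m := by
  obtain ⟨a, h1, h2⟩ := h
  obtain ⟨b, h3, h4⟩ := h'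
  exact ⟨b, (h1.tail ⟨h2, hk⟩).trans h3, h4⟩

theorem CS.mono {N : Type} {E : N → N → Prop} {P Q : N → Prop} {n k : N}
    (hPQ : ∀ x, P x → Q x) (h : CS E P n k) : CS E Q n k := by
  obtain ⟨a, h1, h2⟩ := h
  exact ⟨a, ReflTransGen.mono (fun _ _ h => ⟨h.1, hPQ _ h.2⟩) _ _ h1, h2⟩

theorem TreeRel.cs_and {N : Type} {E : N → N → Prop} (h : TreeRel E) {P Q : N → Prop} {n k : N}
    (h1 : CS E P n k) (h2 : CS E Q n k) : CS E (fun x => P x ∧ Q x) n k := by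
  rw [h.cs_iff] at *
  exact ⟨h1.1, fun j a b => ⟨h1.2 j a b, h2.2 j a b⟩⟩

theorem TreeRel.cs_split {N : Type} {E : N → N → Prop} (h : TreeRel E) {P Q : N → Prop}
    {n k k' : N} (h1 : CS E P n k) (h2 : CS E Q n k') (hk : TransGen E k k') :
    CS E (fun x => P x ∧ Q x) n k ∧ Q k ∧ CS E Q k k' := by
  rw [h.cs_iff] at *
  refine ⟨⟨h1.1, fun j a b => ⟨h1.2 j a b, h2.2 j a (b.trans hk)⟩⟩, h2.2 k h1.1 hk, ?_⟩
  rw [h.cs_iff]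
  exact ⟨hk, fun j a b => h2.2 j (h1.1.trans a) b⟩

inductive Atm (A : Type) : Type where
  | t : CNF A → Atm A
  | c : Atm A
  | s : CNF A → Atm A

def Atm.toC : Atm A → CPF A
  | .t φ => .test φ
  | .c => .child
  | .s φ => .cstar φ

def semL (T : RTree A) : List (Atm A) → T.Node → T.Node → Prop
  | [] => fun n m => n = m
  | a :: l => fun n m => ∃ k, CPF.sem T a.toC n k ∧ semL T l k m

theorem semL_append (T : RTree A) (l l' : List (Atm A)) (n m : T.Node) :
    semL T (l ++ l') n m ↔ ∃ k, semL T l n k ∧ semL T l' k m := by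
  induction l generalizing n with
  | nil => simp [semL]
  | cons a l ih =>
    simp only [List.cons_append, semL, ih]
    constructor
    · rintro ⟨k, h1, j, h2, h3⟩; exact ⟨j, ⟨k, h1, h2⟩, h3⟩
    · rintro ⟨j, ⟨k, h1, h2⟩, h3⟩; exact ⟨k, h1, j, h2, h3⟩

def flat : CPF A → List (Atm A)
  | .child => [.c]
  | .test φ => [.t φ]
  | .comp α β => flat α ++ flat β
  | .cstar φ => [.s φ]

theorem flat_spec (T : RTree A) : ∀ (α : CPF A) (n m : T.Node),
    CPF.sem T α n m ↔ semL T (flat α) n m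
  | .child, n, m => by simp [flat, semL, Atm.toC]
  | .test φ, n, m => by simp [flat, semL, Atm.toC]
  | .comp α β, n, m => by
    rw [flat, semL_append]
    simp only [CPF.sem, flat_spec T α, flat_spec T β]
  | .cstar φ, n, m => by simp [flat, semL, Atm.toC]

theorem sem_cs (T : RTree A) (φ : CNF A) (n m : T.Node) :
    CPF.sem T (.cstar φ) n m ↔ CS T.E (fun x => x ∈ CNF.sat T φ) n m := by
  simp only [CPF.sem, CS]

theorem semL_rtg (T : RTree A) (l : List (Atm A)) (n m : T.Node) (h : semL T l n m) :
    ReflTransGen T.E n m := by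
  induction l generalizing n with
  | nil => simp only [semL] at h; subst h; exact .refl
  | cons a l ih =>
    obtain ⟨k, h1, h2⟩ := h
    refine ReflTransGen.trans ?_ (ih _ h2)
    cases a with
    | t φ => simp only [Atm.toC, CPF.sem] at h1; rw [h1.1]
    | c => simp only [Atm.toC, CPF.sem] at h1; exact .single h1
    | s φ => exact ((sem_cs T φ n k).1 h1).transGen.to_reflTransGen

def URep (R : ∀ T : RTree A, T.Node → T.Node → Prop) : Prop :=
  ∃ L : List (CPF A), ∀ T : RTree A, T.IsTree → ∀ n m : T.Node,
    R T n m ↔ ∃ γ ∈ L, CPF.sem T γ n m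

theorem URep.congr {R R' : ∀ T : RTree A, T.Node → T.Node → Prop} (h : URep R)
    (hh : ∀ T : RTree A, TreeRel T.E → ∀ n m, R' T n m ↔ R T n m) : URep R' := by
  obtain ⟨L, hL⟩ := h
  exact ⟨L, fun T hT n m => (hh T ⟨hT.1.2.2.1, hT.1.2.2.2⟩ n m).trans (hL T hT n m)⟩

theorem URep.empty : URep (fun (T : RTree A) _ _ => False) := ⟨[], by simp⟩

theorem URep.single (γ : CPF A) : URep (fun (T : RTree A) n m => CPF.sem T γ n m) := ⟨[γ], by simp⟩

theorem URep.or {R R' : ∀ T : RTree A, T.Node → T.Node → Prop} (h : URep R) (h' : URep R') :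
    URep (fun T n m => R T n m ∨ R' T n m) := by
  obtain ⟨L, hL⟩ := h
  obtain ⟨L', hL'⟩ := h'
  refine ⟨L ++ L', fun T hT n m => ?_⟩
  simp only [hL T hT, hL' T hT, List.mem_append, or_and_right, exists_or]

theorem URep.pre {R : ∀ T : RTree A, T.Node → T.Node → Prop} (γ : CPF A) (h : URep R) :
    URep (fun T n m => ∃ k, CPF.sem T γ n k ∧ R T k m) := by
  obtain ⟨L, hL⟩ := h
  refine ⟨L.map (CPF.comp γ), fun T hT n m => ?_⟩
  simp only [hL T hT, List.mem_map, exists_exists_and_eq_and, CPF.sem]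
  constructor
  · rintro ⟨k, h1, δ, h2, h3⟩; exact ⟨δ, h2, k, h1, h3⟩
  · rintro ⟨δ, h2, k, h1, h3⟩; exact ⟨k, h1, δ, h2, h3⟩

def Int2 (l l' : List (Atm A)) (T : RTree A) (n m : T.Node) : Prop :=
  semL T l n m ∧ semL T l' n m

theorem URep.swap {l l' : List (Atm A)} (h : URep (Int2 l l')) : URep (Int2 l' l) :=
  h.congr fun _ _ _ _ => and_comm

theorem rep_t (φ : CNF A) {l l' : List (Atm A)} (h : URep (Int2 l l')) :
    URep (Int2 (.t φ :: l) l') := by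
  refine (h.pre (.test φ)).congr fun T _ n m => ?_
  simp only [Int2, semL, Atm.toC, CPF.sem]
  constructor
  · rintro ⟨⟨k, ⟨rfl, h1⟩, h2⟩, h3⟩; exact ⟨n, ⟨rfl, h1⟩, h2, h3⟩
  · rintro ⟨k, ⟨rfl, h1⟩, h2, h3⟩; exact ⟨⟨n, ⟨rfl, h1⟩, h2⟩, h3⟩

theorem rep_nil_c (l : List (Atm A)) : URep (Int2 [] (.c :: l)) := by
  refine URep.empty.congr fun T hT n m => ?_
  simp only [Int2, semL, Atm.toC, CPF.sem, iff_false]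
  rintro ⟨rfl, k, h1, h2⟩
  exact hT.ac _ (TransGen.head' h1 (semL_rtg _ _ _ _ h2))

theorem rep_nil_s (φ : CNF A) (l : List (Atm A)) : URep (Int2 [] (.s φ :: l)) := by
  refine URep.empty.congr fun T hT n m => ?_
  simp only [Int2, semL, Atm.toC, sem_cs, iff_false]
  rintro ⟨rfl, k, h1, h2⟩
  exact hT.ac _ (h1.transGen.trans_left (semL_rtg _ _ _ _ h2))

theorem rep_nil_nil : URep (Int2 ([] : List (Atm A)) []) := by
  refine (URep.single (.test .top)).congr fun T hT n m => ?_
  simp [Int2, semL, CPF.sem, CNF.sat]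

theorem rep_cc {l l' : List (Atm A)} (h : URep (Int2 l l')) :
    URep (Int2 (.c :: l) (.c :: l')) := by
  refine (h.pre .child).congr fun T hT n m => ?_
  simp only [Int2, semL, Atm.toC, CPF.sem]
  constructor
  · rintro ⟨⟨k, h1, h2⟩, k', h3, h4⟩
    have := hT.child_eq h1 h3 (semL_rtg _ _ _ _ h2) (semL_rtg _ _ _ _ h4)
    subst this
    exact ⟨k, h1, h2, h4⟩
  · rintro ⟨k, h1, h2, h3⟩; exact ⟨⟨k, h1, h2⟩, k, h1, h3⟩

theorem rep_cs (φ : CNF A) {l l' : List (Atm A)} (h : URep (Int2 l l'))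
    (h' : URep (Int2 l (.s φ :: l'))) :
    URep (Int2 (.c :: l) (.s φ :: l')) := by
  refine ((h.pre .child).or ((h'.pre (.test φ)).pre .child)).congr fun T hT n m => ?_
  simp only [Int2, semL, Atm.toC, sem_cs]
  simp only [CPF.sem]
  constructor
  · rintro ⟨⟨k, h1, h2⟩, k', h3, h4⟩
    have h4' := semL_rtg _ _ _ _ h4
    rcases CS.iff_head.1 h3 with h5 | ⟨j, h5, h6, h7⟩
    · have := hT.child_eq h1 h5 (semL_rtg _ _ _ _ h2) h4'
      subst this
      exact Or.inl ⟨k, h1, h2, h4⟩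
    · have := hT.child_eq h1 h5 (semL_rtg _ _ _ _ h2) (h7.transGen.to_reflTransGen.trans h4')
      subst this
      exact Or.inr ⟨k, h1, k, ⟨rfl, h6⟩, h2, k', h7, h4⟩
  · rintro (⟨k, h1, h2, h3⟩ | ⟨k, h1, _, ⟨rfl, h6⟩, h2, k', h7, h4⟩)
    · exact ⟨⟨k, h1, h2⟩, k, CS.iff_head.2 (Or.inl h1), h3⟩
    · exact ⟨⟨k, h1, h2⟩, k', CS.iff_head.2 (Or.inr ⟨k, h1, h6, h7⟩), h4⟩

theorem rep_ss (φ ψ : CNF A) {l l' : List (Atm A)} (h : URep (Int2 l l'))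
    (h1 : URep (Int2 l (.s ψ :: l'))) (h2 : URep (Int2 (.s φ :: l) l')) :
    URep (Int2 (.s φ :: l) (.s ψ :: l')) := by
  refine ((h.pre (.cstar (.and φ ψ))).or (((h1.pre (.test ψ)).pre (.cstar (.and φ ψ))).or
    ((h2.pre (.test φ)).pre (.cstar (.and φ ψ))))).congr fun T hT n m => ?_
  simp only [Int2, semL, Atm.toC, sem_cs]
  simp only [CPF.sem, CNF.sat, Set.mem_setOf_eq]
  constructor
  · rintro ⟨⟨k, h3, h4⟩, k', h5, h6⟩
    rcases hT.comparable (semL_rtg _ _ _ _ h4) (semL_rtg _ _ _ _ h6) with h7 | h7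
    · rcases reflTransGen_iff_eq_or_transGen.1 h7 with h8 | h8
      · subst h8
        exact Or.inl ⟨_, hT.cs_and h3 h5, h4, h6⟩
      · obtain ⟨a, b, c⟩ := hT.cs_split h3 h5 h8
        exact Or.inr (Or.inl ⟨k, a, k, ⟨rfl, b⟩, h4, k', c, h6⟩)
    · rcases reflTransGen_iff_eq_or_transGen.1 h7 with h8 | h8
      · subst h8
        exact Or.inl ⟨_, hT.cs_and h3 h5, h4, h6⟩
      · obtain ⟨a, b, c⟩ := hT.cs_split h5 h3 h8
        exact Or.inr (Or.inr ⟨k', a.mono fun _ h => h.symm, k', ⟨rfl, b⟩, ⟨k, c, h4⟩, h6⟩)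
  · rintro (⟨k, a, b, c⟩ | ⟨k, a, _, ⟨rfl, b⟩, c, k', d, e⟩ | ⟨k, a, _, ⟨rfl, b⟩, ⟨k', d, e⟩, c⟩)
    · exact ⟨⟨k, a.mono fun _ h => h.1, b⟩, k, a.mono fun _ h => h.2, c⟩
    · exact ⟨⟨k, a.mono fun _ h => h.1, c⟩, k', (a.mono fun _ h => h.2).trans b d, e⟩
    · exact ⟨⟨k', (a.mono fun _ h => h.1).trans b d, e⟩, k, a.mono fun _ h => h.2, c⟩

theorem rep_all (l : List (Atm A)) : ∀ l' : List (Atm A), URep (Int2 l l') := by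
  induction l with
  | nil =>
    intro l'
    induction l' with
    | nil => exact rep_nil_nil
    | cons b l' ih =>
      cases b with
      | t φ => exact (rep_t φ ih.swap).swap
      | c => exact rep_nil_c l'
      | s φ => exact rep_nil_s φ l'
  | cons a l ih =>
    intro l'
    induction l' with
    | nil =>
      cases a with
      | t φ => exact rep_t φ (ih _)
      | c => exact (rep_nil_c l).swap
      | s φ => exact (rep_nil_s φ l).swap
    | cons b l' ih' =>
      cases b with
      | t φ => exact (rep_t φ ih'.swap).swap
      | c =>
        cases a with
        | t φ => exact rep_t φ (ih _)
        | c => exact rep_cc (ih _)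
        | s φ => exact (rep_cs φ (ih _).swap ih'.swap).swap
      | s ψ =>
        cases a with
        | t φ => exact rep_t φ (ih _)
        | c => exact rep_cs ψ (ih _) (ih _)
        | s φ => exact rep_ss φ ψ (ih _) (ih _) ih'

end Helpers

/-- closure of conditional tree patterns under intersection: for
all CTP path formulas α and β, either their intersection is unsatisfiable over
trees, or it equals a finite union of CTP path formulas on every tree. -/
theorem ctp_closed_under_intersection (α β : CPF A) :
    (∀ T : RTree A, T.IsTree → ∀ n m : T.Node,
        ¬ (CPF.sem T α n m ∧ CPF.sem T β n m)) ∨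
    (∃ L : List (CPF A), ∀ T : RTree A, T.IsTree → ∀ n m : T.Node,
        (CPF.sem T α n m ∧ CPF.sem T β n m) ↔ ∃ γ ∈ L, CPF.sem T γ n m) := by
  right
  obtain ⟨L, hL⟩ := rep_all (flat α) (flat β)
  refine ⟨L, fun T hT n m => ?_⟩
  rw [flat_spec T α, flat_spec T β]
  exact hL T hT n m
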